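/- arXiv:2510.01110 — 4 statements merged into one kernel-verified Lean document; each statement's English description precedes it below -/
import Mathlib

section
/- Let n be even and let N, M ∈ M_n be perfect matchings of K_n on [n] such that N is a switch of M. Then φ(N) < φ(M), where φ(M) := Σ_{(u,v) ∈ M} 2^{u+v}. -/
/-- `M` is a perfect matching of the complete graph on `Fin n`. -/
def IsPerfectMatchingOn (n : ℕ) (M : Finset (Sym2 (Fin n))) : Prop :=
  (∀ e ∈ M, ¬ e.IsDiag) ∧ ∀ v : Fin n, ∃! e, e ∈ M ∧ v ∈ e

/-- `N` is a switch of `M`: the symmetric difference `M △ N` is a single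
4-cycle on vertices `w < x < y < z`, of one of the three types. -/
def IsSwitch {n : ℕ} (N M : Finset (Sym2 (Fin n))) : Prop :=
  ∃ w x y z : Fin n, w < x ∧ x < y ∧ y < z ∧
    ((M \ N = {s(w, x), s(y, z)} ∧ N \ M = {s(w, y), s(x, z)}) ∨
     (M \ N = {s(w, y), s(x, z)} ∧ N \ M = {s(w, z), s(x, y)}) ∨
     (M \ N = {s(w, x), s(y, z)} ∧ N \ M = {s(w, z), s(x, y)}))

/-- The weight `2^{u+v}` of the edge `{u,v}`. -/
def edgeWeight {n : ℕ} : Sym2 (Fin n) → ℕ :=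
  Sym2.lift ⟨fun u v => 2 ^ ((u : ℕ) + (v : ℕ)), fun u v => by simp [Nat.add_comm]⟩

/-- `φ(M) = Σ_{(u,v) ∈ M} 2^{u+v}`. -/
def phi {n : ℕ} (M : Finset (Sym2 (Fin n))) : ℕ := ∑ e ∈ M, edgeWeight e

@[simp]
theorem edgeWeight_mk {n : ℕ} (u v : Fin n) :
    edgeWeight s(u, v) = 2 ^ (u : ℕ) * 2 ^ (v : ℕ) := by
  simp [edgeWeight, pow_add]

theorem sum_edgeWeight_pair {n : ℕ} {a b c d : Fin n} (hac : a ≠ c) (had : a ≠ d) :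
    ∑ e ∈ {s(a, b), s(c, d)}, edgeWeight e =
      2 ^ (a : ℕ) * 2 ^ (b : ℕ) + 2 ^ (c : ℕ) * 2 ^ (d : ℕ) := by
  rw [Finset.sum_pair (by simp [hac, had]), edgeWeight_mk, edgeWeight_mk]

theorem phi_lt_phi_of_sdiff {n : ℕ} {M N : Finset (Sym2 (Fin n))}
    (h : ∑ e ∈ N \ M, edgeWeight e < ∑ e ∈ M \ N, edgeWeight e) : phi N < phi M := by
  have hN := Finset.sum_inter_add_sum_sdiff N M edgeWeight
  have hM := Finset.sum_inter_add_sum_sdiff M N edgeWeight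
  rw [Finset.inter_comm] at hM
  unfold phi
  omega

theorem stmt_5 {n : ℕ} (hn : Even n) (M N : Finset (Sym2 (Fin n)))
    (hM : IsPerfectMatchingOn n M) (hN : IsPerfectMatchingOn n N)
    (hswitch : IsSwitch N M) :
    phi N < phi M := by
  obtain ⟨w, x, y, z, hwx, hxy, hyz, h⟩ := hswitch
  have hwy := hwx.trans hxy
  have hwz := hwy.trans hyz
  have hxz := hxy.trans hyz
  have two_pow_lt {u v : Fin n} (huv : u < v) : 2 ^ (u : ℕ) < 2 ^ (v : ℕ) :=
    Nat.pow_lt_pow_right one_lt_two huv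
  apply phi_lt_phi_of_sdiff
  obtain ⟨h₁, h₂⟩ | ⟨h₁, h₂⟩ | ⟨h₁, h₂⟩ := h
  · rw [h₁, h₂, sum_edgeWeight_pair hwy.ne hwz.ne, sum_edgeWeight_pair hwx.ne hwz.ne]
    nlinarith [two_pow_lt hwz, two_pow_lt hxy]
  · rw [h₁, h₂, sum_edgeWeight_pair hwx.ne hwz.ne, sum_edgeWeight_pair hwx.ne hwy.ne]
    nlinarith [two_pow_lt hwx, two_pow_lt hyz]
  · rw [h₁, h₂, sum_edgeWeight_pair hwy.ne hwz.ne, sum_edgeWeight_pair hwx.ne hwy.ne]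
    nlinarith [two_pow_lt hwy, two_pow_lt hxz]
end

section
/- Let n be even and let N, M ∈ M_n be perfect matchings of K_n on [n] such that N is a switch of M. Then N ⪯ M, i.e., every weakly decreasing sequence (d_1, …, d_n) of non-negative integers that can realize M can also realize N. -/
/-- `(d_1, …, d_n)` can realize the matching `M`: there is a simple graph `G`
on `[n]` with `deg_G(i) = d i` and `M ⊆ E(G)`. -/
def Realizes {n : ℕ} (d : Fin n → ℕ) (M : Finset (Sym2 (Fin n))) : Prop :=
  ∃ G : SimpleGraph (Fin n), (∀ i, (G.neighborSet i).ncard = d i) ∧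
    ∀ e ∈ M, e ∈ G.edgeSet

/-- Exchanging the edges `av`, `bc` for the non-edges `ac`, `bv` preserves all degrees. -/
theorem exists_graph_of_alternating_cycle {V : Type*} [Finite V] (G : SimpleGraph V) {a b c v : V}
    (hav : G.Adj a v) (hbc : G.Adj b c) (hac : ¬ G.Adj a c) (hbv : ¬ G.Adj b v)
    (hne_ac : a ≠ c) (hne_bv : b ≠ v) :
    ∃ H : SimpleGraph V, (∀ i, (H.neighborSet i).ncard = (G.neighborSet i).ncard) ∧
      ∀ p q, H.Adj p q ↔ (G.Adj p q ∧ s(p, q) ≠ s(a, v) ∧ s(p, q) ≠ s(b, c)) ∨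
        s(p, q) = s(a, c) ∨ s(p, q) = s(b, v) := by
  have hne_av := hav.ne
  have hne_bc := hbc.ne
  have hne_cv : c ≠ v := by rintro rfl; exact hac hav
  have hne_ab : a ≠ b := by rintro rfl; exact hac hbc
  let H : SimpleGraph V :=
    { Adj := fun p q => (G.Adj p q ∧ s(p, q) ≠ s(a, v) ∧ s(p, q) ≠ s(b, c)) ∨
        s(p, q) = s(a, c) ∨ s(p, q) = s(b, v)
      symm := ⟨fun p q h => by rwa [Sym2.eq_swap, G.adj_comm]⟩
      loopless := ⟨fun p h => by
        simp only [Sym2.eq_iff, SimpleGraph.irrefl] at h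
        grind⟩ }
  have hadj : ∀ p q, H.Adj p q ↔ (G.Adj p q ∧ s(p, q) ≠ s(a, v) ∧ s(p, q) ≠ s(b, c)) ∨
        s(p, q) = s(a, c) ∨ s(p, q) = s(b, v) := fun _ _ => Iff.rfl
  refine ⟨H, fun i => ?_, hadj⟩
  have key : ∀ {i g l : V}, ¬ G.Adj i g → G.Adj i l →
      (∀ q, H.Adj i q ↔ q = g ∨ (G.Adj i q ∧ q ≠ l)) →
      (H.neighborSet i).ncard = (G.neighborSet i).ncard := by
    intro i g l hg hl h
    rw [← Set.ncard_exchange (s := G.neighborSet i) (a := g) (b := l) hg hl]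
    congr 1
    ext q
    exact h q
  by_cases hia : i = a
  · subst hia
    refine key hac hav fun q => ?_
    rw [hadj]; simp only [ne_eq, Sym2.eq_iff]; grind
  by_cases hib : i = b
  · subst hib
    refine key hbv hbc fun q => ?_
    rw [hadj]; simp only [ne_eq, Sym2.eq_iff]; grind
  by_cases hic : i = c
  · subst hic
    refine key (mt SimpleGraph.Adj.symm hac) hbc.symm fun q => ?_
    rw [hadj]; simp only [ne_eq, Sym2.eq_iff]; grind
  by_cases hiv : i = v
  · subst hiv
    refine key (mt SimpleGraph.Adj.symm hbv) hav.symm fun q => ?_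
    rw [hadj]; simp only [ne_eq, Sym2.eq_iff]; grind
  congr 1
  ext q
  change H.Adj i q ↔ G.Adj i q
  rw [hadj]; simp only [ne_eq, Sym2.eq_iff]; grind

/-- If `b` has degree at most that of `a` and is adjacent to both `c` and `e`, the edge `bc` can be
traded for `ac` while keeping `be` and every edge that avoids `a` and `b`. -/
theorem exists_graph_of_ncard_neighborSet_le {V : Type*} [Finite V] (G : SimpleGraph V)
    {a b c e : V} (hae : G.Adj a e) (hbc : G.Adj b c) (hbe : G.Adj b e) (hac : ¬ G.Adj a c)
    (hne_ac : a ≠ c) (hne_ab : a ≠ b)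
    (hd : (G.neighborSet b).ncard ≤ (G.neighborSet a).ncard) :
    ∃ H : SimpleGraph V, (∀ i, (H.neighborSet i).ncard = (G.neighborSet i).ncard) ∧
      H.Adj a c ∧ H.Adj b e ∧
      ∀ p q, G.Adj p q → a ≠ p → a ≠ q → b ≠ p → b ≠ q → H.Adj p q := by
  obtain ⟨v, hav, hbv, hvb⟩ : ∃ v, G.Adj a v ∧ ¬ G.Adj b v ∧ b ≠ v := by
    by_contra! h
    by_cases hab : G.Adj a b
    · have hsub : insert c (G.neighborSet a \ {b}) ⊆ G.neighborSet b \ {a} := by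
        rintro q (rfl | ⟨hq, hqb⟩)
        · exact ⟨hbc, Ne.symm hne_ac⟩
        · refine ⟨by_contra fun hn => hqb (h q hq hn).symm, ?_⟩
          rintro rfl
          exact G.irrefl hq
      have h₁ := Set.ncard_le_ncard hsub (Set.toFinite _)
      rw [Set.ncard_exchange (s := G.neighborSet a) hac hab] at h₁
      have h₂ := Set.ncard_sdiff_singleton_lt_of_mem (s := G.neighborSet b) (a := a) hab.symm
      omega
    · have hsub : G.neighborSet a ⊂ G.neighborSet b := by
        refine ⟨fun q hq => by_contra fun hn => ?_, fun hs => hac (hs hbc)⟩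
        obtain rfl := h q hq hn
        exact hab hq
      have h₁ := Set.ncard_lt_ncard hsub (Set.toFinite _)
      omega
  obtain ⟨H, hdeg, hadj⟩ :=
    exists_graph_of_alternating_cycle G hav hbc hac hbv hne_ac hvb
  have hne_be := hbe.ne
  have hne_ce : c ≠ e := by rintro rfl; exact hac hae
  refine ⟨H, hdeg, ?_, ?_, fun p q hpq => ?_⟩
  · rw [hadj]; simp
  · rw [hadj]; simp only [ne_eq, Sym2.eq_iff]; grind
  · rw [hadj]; simp only [ne_eq, Sym2.eq_iff]; grind

/-- The edges `ae`, `bc` can be replaced by `ac`, `be` without changing degrees or losing an edge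
that avoids the four vertices, provided `d b ≤ d a` and `d c ≤ d e`. -/
theorem exists_graph_replacing_edges {V : Type*} [Finite V] (G : SimpleGraph V) {a b c e : V}
    (hae : G.Adj a e) (hbc : G.Adj b c) (hne_ac : a ≠ c) (hne_be : b ≠ e) (hne_ab : a ≠ b)
    (hne_ce : c ≠ e) (hab : (G.neighborSet b).ncard ≤ (G.neighborSet a).ncard)
    (hec : (G.neighborSet c).ncard ≤ (G.neighborSet e).ncard) :
    ∃ H : SimpleGraph V, (∀ i, (H.neighborSet i).ncard = (G.neighborSet i).ncard) ∧
      H.Adj a c ∧ H.Adj b e ∧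
      ∀ p q, G.Adj p q → (∀ u ∈ s(p, q), u ≠ a ∧ u ≠ b ∧ u ≠ c ∧ u ≠ e) → H.Adj p q := by
  by_cases hac : G.Adj a c <;> by_cases hbe : G.Adj b e
  · exact ⟨G, fun _ => rfl, hac, hbe, fun _ _ h _ => h⟩
  · obtain ⟨H, hdeg, h₁, h₂, hH⟩ := exists_graph_of_ncard_neighborSet_le G hae.symm hbc.symm
      hac.symm (mt SimpleGraph.Adj.symm hbe) hne_be.symm hne_ce.symm hec
    refine ⟨H, hdeg, h₂.symm, h₁.symm, fun p q hpq hu => ?_⟩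
    have hp := hu p (Sym2.mem_mk_left p q)
    have hq := hu q (Sym2.mem_mk_right p q)
    exact hH p q hpq (by tauto) (by tauto) (by tauto) (by tauto)
  · obtain ⟨H, hdeg, h₁, h₂, hH⟩ := exists_graph_of_ncard_neighborSet_le G hae hbc hbe hac
      hne_ac hne_ab hab
    refine ⟨H, hdeg, h₁, h₂, fun p q hpq hu => ?_⟩
    have hp := hu p (Sym2.mem_mk_left p q)
    have hq := hu q (Sym2.mem_mk_right p q)
    exact hH p q hpq (by tauto) (by tauto) (by tauto) (by tauto)
  · obtain ⟨H, hdeg, hadj⟩ := exists_graph_of_alternating_cycle G hae hbc hac hbe hne_ac hne_be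
    refine ⟨H, hdeg, ?_, ?_, fun p q hpq hu => ?_⟩
    · rw [hadj]; simp
    · rw [hadj]; simp
    · have hp := hu p (Sym2.mem_mk_left p q)
      rw [hadj]; simp only [ne_eq, Sym2.eq_iff]; grind

theorem Realizes.of_sdiff_eq {n : ℕ} {M N : Finset (Sym2 (Fin n))} (hM : IsPerfectMatchingOn n M)
    {a b c e : Fin n} (hMN : M \ N = {s(a, e), s(b, c)}) (hNM : N \ M = {s(a, c), s(b, e)})
    (hne_ac : a ≠ c) (hne_be : b ≠ e) (hne_ab : a ≠ b) (hne_ce : c ≠ e)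
    {d : Fin n → ℕ} (hab : d b ≤ d a) (hec : d c ≤ d e) (hd : Realizes d M) : Realizes d N := by
  obtain ⟨G, hdeg, hG⟩ := hd
  have hae : s(a, e) ∈ M ∧ s(a, e) ∉ N := by
    rw [← Finset.mem_sdiff, hMN]; simp
  have hbc : s(b, c) ∈ M ∧ s(b, c) ∉ N := by
    rw [← Finset.mem_sdiff, hMN]; simp
  obtain ⟨H, hHdeg, h₁, h₂, hH⟩ := exists_graph_replacing_edges G (hG _ hae.1) (hG _ hbc.1)
    hne_ac hne_be hne_ab hne_ce (by rwa [hdeg, hdeg]) (by rwa [hdeg, hdeg])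
  refine ⟨H, fun i => (hHdeg i).trans (hdeg i), fun f hf => ?_⟩
  by_cases hfM : f ∈ M
  · have avoid : ∀ {g : Sym2 (Fin n)}, g ∈ M → g ∉ N → ∀ u ∈ f, u ∉ g := fun hgM hgN u huf hug =>
      hgN ((hM.2 u).unique ⟨hfM, huf⟩ ⟨hgM, hug⟩ ▸ hf)
    have ha := avoid hae.1 hae.2
    have hb := avoid hbc.1 hbc.2
    clear avoid
    induction f with
    | _ p q =>
      refine hH p q (hG _ hfM) fun u hu => ?_
      have hua := ha u hu
      have hub := hb u hu
      simp only [Sym2.mem_iff] at hua hub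
      tauto
  · have hf' : f ∈ N \ M := Finset.mem_sdiff.2 ⟨hf, hfM⟩
    rw [hNM, Finset.mem_insert, Finset.mem_singleton] at hf'
    rcases hf' with rfl | rfl
    · exact h₁
    · exact h₂

theorem stmt_6 {n : ℕ} (hn : Even n) (M N : Finset (Sym2 (Fin n)))
    (hM : IsPerfectMatchingOn n M) (hN : IsPerfectMatchingOn n N)
    (hswitch : IsSwitch N M) :
    ∀ d : Fin n → ℕ, Antitone d → Realizes d M → Realizes d N := by
  intro d hd hr
  obtain ⟨w, x, y, z, hwx, hxy, hyz, ⟨h₁, h₂⟩ | ⟨h₁, h₂⟩ | ⟨h₁, h₂⟩⟩ := hswitch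
  · refine Realizes.of_sdiff_eq (a := x) (b := y) (c := z) (e := w) hM ?_ ?_ (by order) (by order)
      (by order) (by order) (hd (by order)) (hd (by order)) hr
    · rw [h₁, Sym2.eq_swap (a := w)]
    · rw [h₂, Finset.pair_comm, Sym2.eq_swap (a := w)]
  · refine Realizes.of_sdiff_eq (a := y) (b := z) (c := x) (e := w) hM ?_ ?_ (by order) (by order)
      (by order) (by order) (hd (by order)) (hd (by order)) hr
    · rw [h₁, Sym2.eq_swap (a := w), Sym2.eq_swap (a := x)]
    · rw [h₂, Finset.pair_comm, Sym2.eq_swap (a := w), Sym2.eq_swap (a := x)]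
  · refine Realizes.of_sdiff_eq (a := x) (b := z) (c := y) (e := w) hM ?_ ?_ (by order) (by order)
      (by order) (by order) (hd (by order)) (hd (by order)) hr
    · rw [h₁, Sym2.eq_swap (a := w), Sym2.eq_swap (a := y)]
    · rw [h₂, Finset.pair_comm, Sym2.eq_swap (a := w)]
end

section
/- Let n be even and M ∈ M_n. Then M⁻ = {(1,n), (2,n−1), …, (n/2, n/2+1)} is obtainable from M by a sequence of switches: there exist perfect matchings M = N_1, N_2, …, N_k = M⁻ in M_n such that N_{j+1} is a switch of N_j for each j ∈ {1, …, k−1}. -/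
/-- The matching `M⁻ = {(1,n), (2,n−1), …, (n/2, n/2+1)}` (0-indexed: pairs
`{u,v}` with `u + v = n - 1`). -/
def Mminus (n : ℕ) : Finset (Sym2 (Fin n)) :=
  Finset.univ.filter
    (fun e => ∃ u v : Fin n, e = s(u, v) ∧ (u : ℕ) + (v : ℕ) = n - 1)

namespace IsPerfectMatchingOn

variable {n : ℕ} {M : Finset (Sym2 (Fin n))}

theorem eq_of_mem (hM : IsPerfectMatchingOn n M) {e f : Sym2 (Fin n)} {v : Fin n}
    (he : e ∈ M) (hf : f ∈ M) (hve : v ∈ e) (hvf : v ∈ f) : e = f :=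
  (hM.2 v).unique ⟨he, hve⟩ ⟨hf, hvf⟩

theorem mk_right_inj (hM : IsPerfectMatchingOn n M) {u v w : Fin n}
    (hv : s(u, v) ∈ M) (hw : s(u, w) ∈ M) : v = w :=
  Sym2.congr_right.1 (hM.eq_of_mem hv hw (Sym2.mem_mk_left u v) (Sym2.mem_mk_left u w))

theorem exists_mk_mem (hM : IsPerfectMatchingOn n M) (u : Fin n) : ∃ v, s(u, v) ∈ M := by
  obtain ⟨e, ⟨he, v, rfl⟩, -⟩ := hM.2 u
  exact ⟨v, he⟩

theorem ne_of_mk_mem (hM : IsPerfectMatchingOn n M) {u v : Fin n} (h : s(u, v) ∈ M) : u ≠ v := by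
  simpa using hM.1 _ h

end IsPerfectMatchingOn

/-- Replace the edges `ab`, `cd` of `M` by `ad`, `bc`. -/
def reconnect {n : ℕ} (M : Finset (Sym2 (Fin n))) (a b c d : Fin n) : Finset (Sym2 (Fin n)) :=
  (M \ {s(a, b), s(c, d)}) ∪ {s(a, d), s(b, c)}

/-- The sum of the products of the endpoints over all edges. -/
def productSum {n : ℕ} (M : Finset (Sym2 (Fin n))) : ℕ :=
  ∑ e ∈ M, Sym2.lift ⟨fun u v : Fin n => (u : ℕ) * v, fun _ _ => mul_comm _ _⟩ e

section Reconnect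

variable {n : ℕ} {M : Finset (Sym2 (Fin n))} {a b c d : Fin n}

theorem isPerfectMatchingOn_reconnect (hM : IsPerfectMatchingOn n M) (hab : s(a, b) ∈ M)
    (hcd : s(c, d) ∈ M) (hac : a ≠ c) (had : a ≠ d) (hbc : b ≠ c) (hbd : b ≠ d) :
    IsPerfectMatchingOn n (reconnect M a b c d) := by
  have ab := hM.ne_of_mk_mem hab
  have cd := hM.ne_of_mk_mem hcd
  refine ⟨fun e he => ?_, fun v => ?_⟩
  · simp only [reconnect, Finset.mem_union, Finset.mem_sdiff, Finset.mem_insert,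
      Finset.mem_singleton] at he
    rcases he with ⟨he, -⟩ | rfl | rfl
    · exact hM.1 e he
    · simpa using had
    · simpa using hbc
  · obtain ⟨e, ⟨he, hve⟩, -⟩ := hM.2 v
    simp only [reconnect, Finset.mem_union, Finset.mem_sdiff, Finset.mem_insert,
      Finset.mem_singleton]
    have key : ∀ f ∈ M, v ∈ f → f = e := fun f hf hvf => hM.eq_of_mem hf he hvf hve
    by_cases h1 : e = s(a, b)
    · subst h1
      rcases Sym2.mem_iff.1 hve with rfl | rfl
      · exact ⟨s(v, d), by simp, by
          rintro f ⟨⟨hf, hf'⟩ | rfl | rfl, hvf⟩ <;> grind⟩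
      · exact ⟨s(v, c), by simp, by
          rintro f ⟨⟨hf, hf'⟩ | rfl | rfl, hvf⟩ <;> grind⟩
    by_cases h2 : e = s(c, d)
    · subst h2
      rcases Sym2.mem_iff.1 hve with rfl | rfl
      · exact ⟨s(b, v), by simp, by
          rintro f ⟨⟨hf, hf'⟩ | rfl | rfl, hvf⟩ <;> grind⟩
      · exact ⟨s(a, v), by simp, by
          rintro f ⟨⟨hf, hf'⟩ | rfl | rfl, hvf⟩ <;> grind⟩
    · have k1 := key _ hab
      have k2 := key _ hcd
      simp only [Sym2.mem_iff] at k1 k2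
      refine ⟨e, ⟨by tauto, hve⟩, ?_⟩
      rintro f ⟨⟨hf, hf'⟩ | rfl | rfl, hvf⟩ <;> grind

theorem IsPerfectMatchingOn.mk_notMem_of_mk_mem (hM : IsPerfectMatchingOn n M)
    (hab : s(a, b) ∈ M) (hbd : b ≠ d) : s(a, d) ∉ M :=
  fun h => hbd (hM.mk_right_inj hab h)

theorem sdiff_reconnect (hab : s(a, b) ∈ M) (hcd : s(c, d) ∈ M)
    (hac : a ≠ c) (hbd : b ≠ d) : M \ reconnect M a b c d = {s(a, b), s(c, d)} := by
  ext e
  simp only [reconnect, Finset.mem_union, Finset.mem_sdiff, Finset.mem_insert,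
    Finset.mem_singleton]
  constructor
  · tauto
  · rintro (rfl | rfl) <;> simp [*] <;> grind

theorem reconnect_sdiff (had : s(a, d) ∉ M) (hbc : s(b, c) ∉ M) :
    reconnect M a b c d \ M = {s(a, d), s(b, c)} := by
  ext e
  simp only [reconnect, Finset.mem_union, Finset.mem_sdiff, Finset.mem_insert,
    Finset.mem_singleton]
  grind

theorem productSum_reconnect_lt (hab : s(a, b) ∈ M) (hcd : s(c, d) ∈ M)
    (had : s(a, d) ∉ M) (hbc : s(b, c) ∉ M) (ab : a ≠ b) (hac : a < c) (hbd : b < d) :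
    productSum (reconnect M a b c d) < productSum M := by
  have hsub : {s(a, b), s(c, d)} ⊆ M := by simp [Finset.insert_subset_iff, hab, hcd]
  have hdisj : Disjoint (M \ {s(a, b), s(c, d)}) {s(a, d), s(b, c)} := by
    simp [had, hbc]
  have h1 : s(a, b) ≠ s(c, d) := by
    intro h
    simp only [Sym2.eq_iff] at h
    grind
  have h2 : s(a, d) ≠ s(b, c) := by
    intro h
    simp only [Sym2.eq_iff] at h
    grind
  rw [productSum, productSum, reconnect, Finset.sum_union hdisj, ← Finset.sum_sdiff hsub,
    Finset.sum_pair h1, Finset.sum_pair h2]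
  simp only [Sym2.lift_mk]
  have hac' : (a : ℕ) < c := hac
  have hbd' : (b : ℕ) < d := hbd
  have := mul_add_mul_lt_mul_add_mul hac' hbd'
  linarith [mul_comm (b : ℕ) c]

theorem isSwitch_reconnect (hM : IsPerfectMatchingOn n M) (hab : s(a, b) ∈ M)
    (hcd : s(c, d) ∈ M) (ab : a < b) (cd : c < d) (hac : a < c) (hbd : b < d) (hbc : b ≠ c) :
    IsSwitch (reconnect M a b c d) M := by
  have h1 := sdiff_reconnect hab hcd hac.ne hbd.ne
  have h2 := reconnect_sdiff (hM.mk_notMem_of_mk_mem hab hbd.ne)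
    (hM.mk_notMem_of_mk_mem (a := b) (b := a) (by rwa [Sym2.eq_swap]) hac.ne)
  rcases hbc.lt_or_gt with h | h
  · exact ⟨a, b, c, d, ab, h, cd, Or.inr (Or.inr ⟨h1, h2⟩)⟩
  · exact ⟨a, c, b, d, hac, h, hbd, Or.inr (Or.inl ⟨h1, by rw [h2, Sym2.eq_swap (a := b)]⟩)⟩

end Reconnect

theorem IsPerfectMatchingOn.exists_isSwitch_productSum_lt {n : ℕ} {M : Finset (Sym2 (Fin n))}
    (hM : IsPerfectMatchingOn n M) {u u' v v' : Fin n} (hu : s(u, u') ∈ M) (hv : s(v, v') ∈ M)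
    (huv : u < v) (huv' : u' < v') :
    ∃ N, IsPerfectMatchingOn n N ∧ IsSwitch N M ∧ productSum N < productSum M := by
  have of_sorted : ∀ a b c d : Fin n, s(a, b) ∈ M → s(c, d) ∈ M → a < b → c < d → a < c → b < d →
      ∃ N, IsPerfectMatchingOn n N ∧ IsSwitch N M ∧ productSum N < productSum M := by
    intro a b c d hab hcd ab cd hac hbd
    have had : a ≠ d := (hac.trans cd).ne
    have hba : s(b, a) ∈ M := by rwa [Sym2.eq_swap]
    have hbc : b ≠ c := by
      rintro rfl
      exact had (hM.mk_right_inj hba hcd)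
    exact ⟨reconnect M a b c d, isPerfectMatchingOn_reconnect hM hab hcd hac.ne had hbc hbd.ne,
      isSwitch_reconnect hM hab hcd ab cd hac hbd hbc,
      productSum_reconnect_lt hab hcd (hM.mk_notMem_of_mk_mem hab hbd.ne)
        (hM.mk_notMem_of_mk_mem hba hac.ne) ab.ne hac hbd⟩
  have hu' : s(u', u) ∈ M := by rwa [Sym2.eq_swap]
  have hv' : s(v', v) ∈ M := by rwa [Sym2.eq_swap]
  rcases (hM.ne_of_mk_mem hu).lt_or_gt with h | h <;>
    rcases (hM.ne_of_mk_mem hv).lt_or_gt with k | k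
  · exact of_sorted u u' v v' hu hv h k huv huv'
  · exact of_sorted u u' v' v hu hv' h k (h.trans huv') (huv'.trans k)
  · exact of_sorted u' u v v' hu' hv h k (h.trans huv) (huv.trans k)
  · exact of_sorted u' u v' v hu' hv' h k huv' huv

theorem IsPerfectMatchingOn.eq_Mminus_of_strictAnti {n : ℕ} {M : Finset (Sym2 (Fin n))}
    (hM : IsPerfectMatchingOn n M) {σ : Fin n → Fin n} (hσ : ∀ u, s(u, σ u) ∈ M)
    (hanti : StrictAnti σ) : M = Mminus n := by
  have hrev : ∀ u, σ u = Fin.rev u := by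
    intro u
    have hmono : StrictMono (Fin.rev ∘ σ) := Fin.rev_strictAnti.comp hanti
    have hid : Fin.rev ∘ σ = id :=
      (hmono.range_inj strictMono_id).1 (by
        rw [(Finite.injective_iff_surjective.1 hmono.injective).range_eq, Set.range_id])
    rw [← Fin.rev_rev (σ u)]
    exact congrArg Fin.rev (congrFun hid u)
  have hmem : ∀ u v : Fin n, s(u, v) ∈ M ↔ σ u = v :=
    fun u v => ⟨fun h => hM.mk_right_inj (hσ u) h, fun h => h ▸ hσ u⟩
  have hsum : ∀ u v : Fin n, σ u = v ↔ (u : ℕ) + v = n - 1 := by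
    intro u v
    rw [hrev, Fin.ext_iff, Fin.val_rev]
    omega
  ext e
  induction e with | _ u v => ?_
  simp only [Mminus, Finset.mem_filter, Finset.mem_univ, true_and]
  rw [hmem, hsum]
  refine ⟨fun h => ⟨u, v, rfl, h⟩, ?_⟩
  rintro ⟨a, b, h, hab⟩
  rcases Sym2.eq_iff.1 h with ⟨rfl, rfl⟩ | ⟨rfl, rfl⟩ <;> omega

/-- `M⁻` is obtainable from `M` by a sequence of switches: there are
`M = N_1, N_2, …, N_k = M⁻` with each `N_{j+1}` a switch of `N_j`. -/
theorem stmt_7 {n : ℕ} (hn : Even n) (M : Finset (Sym2 (Fin n)))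
    (hM : IsPerfectMatchingOn n M) :
    Relation.ReflTransGen (fun A B : Finset (Sym2 (Fin n)) => IsSwitch B A)
      M (Mminus n) := by
  induction h : productSum M using Nat.strong_induction_on generalizing M with
  | _ k ih =>
    subst h
    choose σ hσ using hM.exists_mk_mem
    by_cases hanti : StrictAnti σ
    · rw [hM.eq_Mminus_of_strictAnti hσ hanti]
    · simp only [StrictAnti, not_forall, not_lt] at hanti
      obtain ⟨u, v, huv, hle⟩ := hanti
      have hne : σ u ≠ σ v := by
        intro h
        have hu : s(σ u, u) ∈ M := Sym2.eq_swap ▸ hσ u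
        have hv : s(σ u, v) ∈ M := by
          rw [h, Sym2.eq_swap]
          exact hσ v
        exact huv.ne (hM.mk_right_inj hu hv)
      obtain ⟨N, hN, hsw, hlt⟩ :=
        hM.exists_isSwitch_productSum_lt (hσ u) (hσ v) huv (hle.lt_of_ne hne)
      exact .head hsw (ih _ hlt N hN rfl)
end

section
/- Let n be even and M ∈ M_n. If no perfect matching N ∈ M_n is a switch of M, then M = M⁻ = {(1,n), (2,n−1), …, (n/2, n/2+1)}. Equivalently, if for every two edges e = (w,x) and e' = (y,z) of M (with w < x, y < z) the real intervals [w,x] and [y,z] are nested (one contains the other), then M = M⁻. -/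
section Matching

variable {n : ℕ} {M : Finset (Sym2 (Fin n))}

theorem IsPerfectMatchingOn.eq_of_mem_s9 (hM : IsPerfectMatchingOn n M) {e f : Sym2 (Fin n)}
    {v : Fin n} (he : e ∈ M) (hf : f ∈ M) (hve : v ∈ e) (hvf : v ∈ f) : e = f :=
  (hM.2 v).unique ⟨he, hve⟩ ⟨hf, hvf⟩

/-- Replacing two disjoint edges `ab`, `cd` of a perfect matching by `ac`, `bd` gives a perfect
matching whose symmetric difference with the original is that 4-cycle. -/
theorem IsPerfectMatchingOn.exists_exchange (hM : IsPerfectMatchingOn n M) {a b c d : Fin n}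
    (hab : s(a, b) ∈ M) (hcd : s(c, d) ∈ M)
    (nac : a ≠ c) (nad : a ≠ d) (nbc : b ≠ c) (nbd : b ≠ d) :
    ∃ N, IsPerfectMatchingOn n N ∧ M \ N = {s(a, b), s(c, d)} ∧
      N \ M = {s(a, c), s(b, d)} := by
  have nab : a ≠ b := fun h => hM.1 _ hab (by simpa using h)
  have ncd : c ≠ d := fun h => hM.1 _ hcd (by simpa using h)
  have ha : ∀ e ∈ M, a ∈ e → e = s(a, b) := fun e he h => hM.eq_of_mem_s9 he hab h (by simp)
  have hb : ∀ e ∈ M, b ∈ e → e = s(a, b) := fun e he h => hM.eq_of_mem_s9 he hab h (by simp)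
  have hc : ∀ e ∈ M, c ∈ e → e = s(c, d) := fun e he h => hM.eq_of_mem_s9 he hcd h (by simp)
  have hd : ∀ e ∈ M, d ∈ e → e = s(c, d) := fun e he h => hM.eq_of_mem_s9 he hcd h (by simp)
  have hac : s(a, c) ∉ M := fun h => by
    have := ha _ h (by simp)
    grind
  have hbd : s(b, d) ∉ M := fun h => by
    have := hb _ h (by simp)
    grind
  have h1 : s(a, b) ≠ s(a, c) := by grind
  have h2 : s(a, b) ≠ s(b, d) := by grind
  have h3 : s(c, d) ≠ s(a, c) := by grind
  have h4 : s(c, d) ≠ s(b, d) := by grind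
  refine ⟨(M \ {s(a, b), s(c, d)}) ∪ {s(a, c), s(b, d)}, ⟨?_, ?_⟩, ?_, ?_⟩
  · intro e he
    simp only [Finset.mem_union, Finset.mem_sdiff, Finset.mem_insert, Finset.mem_singleton] at he
    rcases he with he | rfl | rfl
    · exact hM.1 e he.1
    · simpa using nac
    · simpa using nbd
  · intro v
    simp only [Finset.mem_union, Finset.mem_sdiff, Finset.mem_insert, Finset.mem_singleton]
    by_cases hv : v = a ∨ v = c
    · refine ⟨s(a, c), ⟨by simp, by simpa using hv⟩, ?_⟩
      rintro e ⟨he | rfl | rfl, hve⟩ <;> grind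
    by_cases hv' : v = b ∨ v = d
    · refine ⟨s(b, d), ⟨by simp, by simpa using hv'⟩, ?_⟩
      rintro e ⟨he | rfl | rfl, hve⟩ <;> grind
    obtain ⟨e, ⟨he, hve⟩, huniq⟩ := hM.2 v
    refine ⟨e, ⟨.inl ⟨he, ?_⟩, hve⟩, ?_⟩
    · rintro (rfl | rfl) <;> simp only [Sym2.mem_iff] at hve <;> grind
    · rintro f ⟨hf | rfl | rfl, hvf⟩
      · exact huniq f ⟨hf.1, hvf⟩
      all_goals simp only [Sym2.mem_iff] at hvf; grind
  · ext e
    simp only [Finset.mem_union, Finset.mem_sdiff, Finset.mem_insert, Finset.mem_singleton]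
    grind
  · ext e
    simp only [Finset.mem_union, Finset.mem_sdiff, Finset.mem_insert, Finset.mem_singleton]
    grind

/-- If two edges of a perfect matching are not nested, the matching has a switch. -/
theorem IsPerfectMatchingOn.exists_isSwitch (hM : IsPerfectMatchingOn n M) {a b c d : Fin n}
    (hab : s(a, b) ∈ M) (hcd : s(c, d) ∈ M) (lab : a < b) (lcd : c < d)
    (lac : a < c) (lbd : b < d) : ∃ N, IsPerfectMatchingOn n N ∧ IsSwitch N M := by
  have nbc : b ≠ c := by
    rintro rfl
    have := hM.eq_of_mem_s9 (v := b) hab hcd (by simp) (by simp)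
    grind
  rcases lt_or_gt_of_ne nbc with h | h
  · obtain ⟨N, hN, h1, h2⟩ := hM.exists_exchange hab hcd lac.ne (by grind) nbc lbd.ne
    exact ⟨N, hN, a, b, c, d, lab, h, lcd, .inl ⟨h1, h2⟩⟩
  · obtain ⟨N, hN, h1, h2⟩ :=
      hM.exists_exchange hab (Sym2.eq_swap ▸ hcd) (by grind) lac.ne lbd.ne nbc
    refine ⟨N, hN, a, c, b, d, lac, h, lbd, .inr (.inl ⟨?_, ?_⟩)⟩
    · rw [h1, Sym2.eq_swap (a := d)]
    · rw [h2, Sym2.eq_swap (a := b)]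

end Matching

/-- If no perfect matching `N` is a switch of `M`, then `M = M⁻`. -/
theorem stmt_9 {n : ℕ} (hn : Even n) (M : Finset (Sym2 (Fin n)))
    (hM : IsPerfectMatchingOn n M)
    (hno : ∀ N : Finset (Sym2 (Fin n)), IsPerfectMatchingOn n N → ¬ IsSwitch N M) :
    M = Mminus n := by
  have hex : ∀ v : Fin n, ∃ w, s(v, w) ∈ M := fun v => by
    obtain ⟨e, ⟨he, w, rfl⟩, -⟩ := hM.2 v
    exact ⟨w, he⟩
  choose p hp using hex
  have hp_eq : ∀ v w, s(v, w) ∈ M → w = p v := fun v w h =>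
    Sym2.congr_right.1 (hM.eq_of_mem_s9 (v := v) h (hp v) (by simp) (by simp))
  have hpp : ∀ v, p (p v) = v := fun v => (hp_eq _ _ (Sym2.eq_swap ▸ hp v)).symm
  have hne : ∀ v, v ≠ p v := fun v h => hM.1 _ (hp v) (by simpa using h)
  have hns : ∀ a b c d : Fin n, s(a, b) ∈ M → s(c, d) ∈ M → a < b → c < d → a < c →
      ¬ b < d := fun a b c d hab hcd lab lcd lac lbd =>
    let ⟨N, hN, h⟩ := hM.exists_isSwitch hab hcd lab lcd lac lbd
    hno N hN h
  have hp' : ∀ v, s(p v, v) ∈ M := fun v => Sym2.eq_swap ▸ hp v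
  have hanti : StrictAnti p := by
    intro a b hab
    by_contra hle
    have hlt : p a < p b := lt_of_le_of_ne (not_lt.1 hle) fun h => hab.ne (by
      rw [← hpp a, h, hpp])
    rcases lt_or_gt_of_ne (hne a) with h1 | h1 <;> rcases lt_or_gt_of_ne (hne b) with h2 | h2
    · exact hns _ _ _ _ (hp a) (hp b) h1 h2 hab hlt
    · exact hns _ _ _ _ (hp a) (hp' b) h1 h2 (h1.trans hlt) (hlt.trans h2)
    · exact hns _ _ _ _ (hp' a) (hp b) h1 h2 (h1.trans hab) (hab.trans h2)
    · exact hns _ _ _ _ (hp' a) (hp' b) h1 h2 hlt hab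
  have hmono : StrictMono (Fin.rev ∘ p) := fun a b h => Fin.rev_lt_rev.2 (hanti h)
  have hrev : ∀ v, p v = Fin.rev v := fun v => by
    have : Fin.rev (p v) = v := le_antisymm (hmono.apply_le) (hmono.le_apply)
    rw [← this, Fin.rev_rev, this]
  ext e
  induction e with | _ u v
  have key : s(u, v) ∈ M ↔ (u : ℕ) + v = n - 1 := by
    have : s(u, v) ∈ M ↔ v = p u := ⟨hp_eq u v, fun h => h ▸ hp u⟩
    rw [this, hrev, Fin.ext_iff, Fin.val_rev]
    omega
  rw [key]
  simp only [Mminus, Finset.mem_filter, Finset.mem_univ, true_and]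
  refine ⟨fun h => ⟨u, v, rfl, h⟩, ?_⟩
  rintro ⟨a, b, h, hab⟩
  rcases Sym2.eq_iff.1 h with ⟨rfl, rfl⟩ | ⟨rfl, rfl⟩ <;> omega
end
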